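/- Watson's transformation of a terminating ₈W₇ into a terminating balanced ₄φ₃: for n ∈ ℕ and nonzero complex numbers q, a, b, c, d, e with 0 < |q| < 1 such that no factor in the denominators below vanishes, ∑_{k=0}^n ((1 − a q^{2k})/(1 − a)) · ((a;q)_k (b;q)_k (c;q)_k (d;q)_k (e;q)_k (q^{−n};q)_k) / ((q;q)_k (qa/b;q)_k (qa/c;q)_k (qa/d;q)_k (qa/e;q)_k (q^{n+1}a;q)_k) · (q^{n+2}a²/(bcde))^k = ((qa;q)_n (qa/(de);q)_n / ((qa/d;q)_n (qa/e;q)_n)) · ∑_{k=0}^n ((q^{−n};q)_k (d;q)_k (e;q)_k (qa/(bc);q)_k) / ((qa/b;q)_k (qa/c;q)_k (q^{−n}de/a;q)_k (q;q)_k) · q^k. -/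

import Mathlib

/-- The finite `q`-shifted factorial `(a;q)_k`. -/
noncomputable def qPoch (a q : ℂ) (k : ℕ) : ℂ := ∏ j ∈ Finset.range k, (1 - a * q ^ j)

theorem qPoch_zero (a q : ℂ) : qPoch a q 0 = 1 := by simp [qPoch]

theorem qPoch_succ (a q : ℂ) (k : ℕ) : qPoch a q (k + 1) = qPoch a q k * (1 - a * q ^ k) :=
  Finset.prod_range_succ _ _

theorem qPoch_add (a q : ℂ) (j k : ℕ) :
    qPoch a q (j + k) = qPoch a q j * qPoch (a * q ^ j) q k := by
  simp only [qPoch, Finset.prod_range_add, pow_add, mul_assoc]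

theorem qPoch_succ' (a q : ℂ) (k : ℕ) : qPoch a q (k + 1) = (1 - a) * qPoch (a * q) q k := by
  rw [add_comm, qPoch_add]
  simp [qPoch]

theorem qPoch_ne_zero_of_le {a q : ℂ} {j k : ℕ} (hjk : j ≤ k) (h : qPoch a q k ≠ 0) :
    qPoch a q j ≠ 0 := by
  obtain ⟨i, rfl⟩ := Nat.exists_eq_add_of_le hjk
  rw [qPoch_add] at h
  exact left_ne_zero_of_mul h

theorem qPoch_inv_pow_eq_zero {q : ℂ} (hq : q ≠ 0) {j k : ℕ} (h : j < k) :
    qPoch (q ^ j)⁻¹ q k = 0 :=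
  Finset.prod_eq_zero (Finset.mem_range.2 h) (by simp [hq])

/-- The summand of the very-well-poised `₆φ₅` series with `q ^ n` replaced by `N`. -/
noncomputable def wellPoisedTerm (q a d e N : ℂ) (k : ℕ) : ℂ :=
  (1 - a * q ^ (2 * k)) / (1 - a) *
    (qPoch a q k * qPoch d q k * qPoch e q k * qPoch N⁻¹ q k) /
    (qPoch q q k * qPoch (q * a / d) q k * qPoch (q * a / e) q k * qPoch (q * N * a) q k) *
    (q * N * a / (d * e)) ^ k

theorem sum_wellPoisedTerm_contiguous {q a d e N : ℂ} (hq : q ≠ 0) (ha1 : 1 - a ≠ 0)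
    (hd : d ≠ 0) (he : e ≠ 0) (hN : N ≠ 0) (m : ℕ) (h1 : qPoch q q m ≠ 0)
    (h2 : qPoch (q * a / d) q m ≠ 0) (h3 : qPoch (q * a / e) q m ≠ 0)
    (h4 : qPoch (q * N * a) q (m + 1) ≠ 0) :
    ∑ k ∈ Finset.range (m + 1),
        ((1 - a * q * N / d) * (1 - a * q * N / e) * wellPoisedTerm q a d e (q * N) k -
          (1 - a * q * N) * (1 - a * q * N / (d * e)) * wellPoisedTerm q a d e N k) =
      qPoch (a * q) q m * qPoch d q (m + 1) * qPoch e q (m + 1) * qPoch N⁻¹ q m /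
        (qPoch q q m * qPoch (q * a / d) q m * qPoch (q * a / e) q m *
          qPoch (q * (q * N) * a) q m) * (q * N * a / (d * e)) ^ (m + 1) := by
  induction m with
  | zero =>
    simp [wellPoisedTerm, qPoch_zero, qPoch_succ, ha1]
    field_simp
    ring
  | succ m ih =>
    have hN4 : q * N * a * q = q * (q * N) * a := by ring
    have hNi : (q * N)⁻¹ * q = N⁻¹ := by field_simp
    rw [Finset.sum_range_succ, ih (qPoch_ne_zero_of_le m.le_succ h1)
      (qPoch_ne_zero_of_le m.le_succ h2) (qPoch_ne_zero_of_le m.le_succ h3)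
      (qPoch_ne_zero_of_le (m + 1).le_succ h4)]
    clear ih
    rw [qPoch_succ', hN4] at h4
    simp only [wellPoisedTerm, qPoch_succ' a, qPoch_succ' (q * N * a), qPoch_succ' (q * N)⁻¹,
      hN4, hNi]
    rw [qPoch_succ] at h1 h2 h3 h4
    simp only [qPoch_succ]
    rw [mul_comm 2, pow_mul, pow_succ q]
    generalize qPoch q q m = x1 at *
    generalize qPoch (q * a / d) q m = x2 at *
    generalize qPoch (q * a / e) q m = x3 at *
    generalize qPoch (q * (q * N) * a) q m = x4 at *
    generalize qPoch (a * q) q m = y1 at *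
    generalize qPoch d q m = y2 at *
    generalize qPoch e q m = y3 at *
    generalize qPoch N⁻¹ q m = y4 at *
    have hz : (q * (q * N) * a / (d * e)) ^ (m + 1) =
        (q ^ m * q) * (q * N * a / (d * e)) ^ (m + 1) := by
      rw [← pow_succ, ← mul_pow]; ring
    rw [hz, pow_succ _ (m + 1)]
    generalize (q * N * a / (d * e)) ^ (m + 1) = z at *
    generalize q ^ m = Q at *
    simp only [mul_ne_zero_iff] at h1 h2 h3 h4
    obtain ⟨h1, h1'⟩ := h1
    obtain ⟨h2, h2'⟩ := h2
    obtain ⟨h3, h3'⟩ := h3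
    obtain ⟨h4, h4', h4''⟩ := h4
    have e2 : 1 - q * a / d * Q = (d - q * a * Q) / d := by field_simp
    have e3 : 1 - q * a / e * Q = (e - q * a * Q) / e := by field_simp
    rw [e2] at h2' ⊢
    rw [e3] at h3' ⊢
    replace h2' := (div_ne_zero_iff.1 h2').1
    replace h3' := (div_ne_zero_iff.1 h3').1
    generalize hu1 : 1 - q * Q = u1 at *
    generalize hu2 : d - q * a * Q = u2 at *
    generalize hu3 : e - q * a * Q = u3 at *
    generalize hu4 : 1 - q * N * a = u4 at *
    generalize hu5 : 1 - q * (q * N) * a * Q = u5 at *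
    generalize hu6 : 1 - a = u6 at *
    field_simp
    subst hu1 hu2 hu3 hu4 hu5 hu6
    ring

theorem sum_wellPoisedTerm {q a d e : ℂ} (hq : q ≠ 0) (hd : d ≠ 0) (he : e ≠ 0) (n : ℕ)
    (hqn : qPoch q q n ≠ 0) (ha : ∀ m ≤ 2 * n, 1 - a * q ^ m ≠ 0)
    (h2 : qPoch (q * a / d) q n ≠ 0) (h3 : qPoch (q * a / e) q n ≠ 0) :
    ∑ k ∈ Finset.range (n + 1), wellPoisedTerm q a d e (q ^ n) k =
      qPoch (q * a) q n * qPoch (q * a / (d * e)) q n /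
        (qPoch (q * a / d) q n * qPoch (q * a / e) q n) := by
  have ha1 : 1 - a ≠ 0 := by simpa using ha 0 (Nat.zero_le _)
  induction n with
  | zero => simp [wellPoisedTerm, qPoch_zero, ha1]
  | succ n ih =>
    have h4 : qPoch (q * q ^ n * a) q (n + 1 + 1) ≠ 0 :=
      Finset.prod_ne_zero_iff.2 fun j hj => by
        have := ha (n + 1 + j) (by have := Finset.mem_range.1 hj; omega)
        convert this using 2
        ring
    have key := sum_wellPoisedTerm_contiguous hq ha1 hd he (pow_ne_zero n hq) (n + 1) hqn h2 h3 h4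
    have ih := ih (qPoch_ne_zero_of_le n.le_succ hqn) (fun m hm => ha m (by omega))
      (qPoch_ne_zero_of_le n.le_succ h2) (qPoch_ne_zero_of_le n.le_succ h3)
    rw [qPoch_inv_pow_eq_zero hq n.lt_succ_self, Finset.sum_sub_distrib, ← Finset.mul_sum,
      ← Finset.mul_sum, Finset.sum_range_succ (wellPoisedTerm q a d e (q ^ n)), ih] at key
    have h0 : wellPoisedTerm q a d e (q ^ n) (n + 1) = 0 := by
      simp [wellPoisedTerm, qPoch_inv_pow_eq_zero hq n.lt_succ_self]
    rw [h0, ← pow_succ'] at key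
    have e1 : q * a * q ^ n = a * q * q ^ n := by ring
    simp only [qPoch_succ, div_mul_eq_mul_div, e1] at h2 h3 ⊢
    rw [mul_ne_zero_iff] at h2 h3
    obtain ⟨h2, h2'⟩ := h2
    obtain ⟨h3, h3'⟩ := h3
    have key := sub_eq_zero.1 (key.trans (by simp))
    rw [← mul_right_inj' (mul_ne_zero h2' h3'), key, add_zero]
    generalize 1 - a * q * q ^ n / d = x at *
    generalize 1 - a * q * q ^ n / e = y at *
    field_simp

/-- The summand of a balanced `₃φ₂` series with `q ^ k` replaced by `K`, as it occurs in the
`q`-Pfaff–Saalschütz summation. -/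
noncomputable def saalschutzTerm (q a b c K : ℂ) (j : ℕ) : ℂ :=
  qPoch K⁻¹ q j * qPoch (a * K) q j * qPoch (q * a / (b * c)) q j /
    (qPoch q q j * qPoch (q * a / b) q j * qPoch (q * a / c) q j) * q ^ j

theorem sum_saalschutzTerm_contiguous {q a b c K : ℂ} (hq : q ≠ 0)
    (hb : b ≠ 0) (hc : c ≠ 0) (hK : K ≠ 0) (m : ℕ) (h1 : qPoch q q m ≠ 0)
    (h2 : qPoch (q * a / b) q m ≠ 0) (h3 : qPoch (q * a / c) q m ≠ 0) :
    ∑ j ∈ Finset.range (m + 1),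
        ((1 - q * a / b * K) * (1 - q * a / c * K) * saalschutzTerm q a b c (q * K) j -
          q * a / (b * c) * (1 - b * K) * (1 - c * K) * saalschutzTerm q a b c K j) =
      (1 - a * q * K ^ 2) * qPoch K⁻¹ q m * qPoch (a * (q * K)) q m *
        qPoch (q * a / (b * c)) q (m + 1) /
        (qPoch q q m * qPoch (q * a / b) q m * qPoch (q * a / c) q m) := by
  induction m with
  | zero =>
    simp [saalschutzTerm, qPoch_zero, qPoch_succ]
    field_simp
    ring
  | succ m ih =>
    have hK1 : a * K * q = a * (q * K) := by ring
    have hKi : (q * K)⁻¹ * q = K⁻¹ := by field_simp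
    rw [Finset.sum_range_succ, ih (qPoch_ne_zero_of_le m.le_succ h1)
      (qPoch_ne_zero_of_le m.le_succ h2) (qPoch_ne_zero_of_le m.le_succ h3)]
    clear ih
    simp only [saalschutzTerm, qPoch_succ' (a * K), qPoch_succ' (q * K)⁻¹, hK1, hKi]
    rw [qPoch_succ] at h1 h2 h3
    simp only [qPoch_succ, pow_succ q]
    generalize qPoch q q m = x1 at *
    generalize qPoch (q * a / b) q m = x2 at *
    generalize qPoch (q * a / c) q m = x3 at *
    generalize qPoch (q * a / (b * c)) q m = y1 at *
    generalize qPoch (a * (q * K)) q m = y2 at *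
    generalize qPoch K⁻¹ q m = y4 at *
    generalize q ^ m = Q at *
    simp only [mul_ne_zero_iff] at h1 h2 h3
    obtain ⟨h1, h1'⟩ := h1
    obtain ⟨h2, h2'⟩ := h2
    obtain ⟨h3, h3'⟩ := h3
    have e2 : 1 - q * a / b * Q = (b - q * a * Q) / b := by field_simp
    have e3 : 1 - q * a / c * Q = (c - q * a * Q) / c := by field_simp
    rw [e2] at h2' ⊢
    rw [e3] at h3' ⊢
    replace h2' := (div_ne_zero_iff.1 h2').1
    replace h3' := (div_ne_zero_iff.1 h3').1
    generalize hu1 : 1 - q * Q = u1 at *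
    generalize hu2 : b - q * a * Q = u2 at *
    generalize hu3 : c - q * a * Q = u3 at *
    field_simp
    subst hu1 hu2 hu3
    ring

theorem sum_saalschutzTerm {q a b c : ℂ} (hq : q ≠ 0) (hb : b ≠ 0) (hc : c ≠ 0) (k : ℕ)
    (hqk : qPoch q q k ≠ 0) (h2 : qPoch (q * a / b) q k ≠ 0) (h3 : qPoch (q * a / c) q k ≠ 0) :
    ∑ j ∈ Finset.range (k + 1), saalschutzTerm q a b c (q ^ k) j =
      qPoch b q k * qPoch c q k / (qPoch (q * a / b) q k * qPoch (q * a / c) q k) *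
        (q * a / (b * c)) ^ k := by
  induction k with
  | zero => simp [saalschutzTerm, qPoch_zero]
  | succ k ih =>
    have key := sum_saalschutzTerm_contiguous hq hb hc (pow_ne_zero k hq) (k + 1) hqk h2 h3
    have ih := ih (qPoch_ne_zero_of_le k.le_succ hqk)
      (qPoch_ne_zero_of_le k.le_succ h2) (qPoch_ne_zero_of_le k.le_succ h3)
    rw [qPoch_inv_pow_eq_zero hq k.lt_succ_self, Finset.sum_sub_distrib, ← Finset.mul_sum,
      ← Finset.mul_sum, Finset.sum_range_succ (saalschutzTerm q a b c (q ^ k)), ih] at key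
    have h0 : saalschutzTerm q a b c (q ^ k) (k + 1) = 0 := by
      simp [saalschutzTerm, qPoch_inv_pow_eq_zero hq k.lt_succ_self]
    rw [h0, ← pow_succ'] at key
    simp only [qPoch_succ, pow_succ (q * a / (b * c))] at h2 h3 ⊢
    rw [mul_ne_zero_iff] at h2 h3
    obtain ⟨h2, h2'⟩ := h2
    obtain ⟨h3, h3'⟩ := h3
    have key := sub_eq_zero.1 (key.trans (by simp))
    rw [← mul_right_inj' (mul_ne_zero h2' h3'), key, add_zero]
    generalize 1 - q * a / b * q ^ k = x at *
    generalize 1 - q * a / c * q ^ k = y at *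
    field_simp

theorem qPoch_reverse {q z : ℂ} (hq : q ≠ 0) (hz : z ≠ 0) (j : ℕ) :
    qPoch (q / (z * q ^ j)) q j = qPoch z q j * (-1 / z) ^ j / q ^ j.choose 2 := by
  induction j with
  | zero => simp [qPoch_zero]
  | succ j ih =>
    have h : q / (z * q ^ (j + 1)) * q = q / (z * q ^ j) := by
      rw [pow_succ]; field_simp
    have hch : q ^ (j + 1).choose 2 = q ^ j * q ^ j.choose 2 := by
      rw [← pow_add, Nat.choose_succ_succ' j 1, Nat.choose_one_right]
    have hj : q ^ j ≠ 0 := pow_ne_zero j hq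
    rw [qPoch_succ', h, ih, qPoch_succ, hch, pow_succ (-1 / z), pow_succ q]
    clear ih h hch
    have hc : q ^ j.choose 2 ≠ 0 := pow_ne_zero _ hq
    generalize q ^ j.choose 2 = w at *
    generalize (-1 / z) ^ j = v at *
    generalize q ^ j = Q at *
    field_simp
    ring

theorem wellPoisedTerm_mul_qPoch {q a d e : ℂ} (hq : q ≠ 0) (hd : d ≠ 0) (he : e ≠ 0)
    (ha1 : 1 - a ≠ 0) (j r i : ℕ) (hqi : qPoch q q (j + i) ≠ 0) (haj : 1 - a * q ^ (2 * j) ≠ 0) :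
    wellPoisedTerm q a d e (q ^ (j + r)) (j + i) *
        (qPoch (q ^ (j + i))⁻¹ q j * qPoch (a * q ^ (j + i)) q j) =
      (-1 / q) ^ j / q ^ j.choose 2 *
          (qPoch (q * a) q (2 * j) * qPoch d q j * qPoch e q j * qPoch (q ^ (j + r))⁻¹ q j) /
          (qPoch (q * a / d) q j * qPoch (q * a / e) q j * qPoch (q * q ^ (j + r) * a) q j) *
          (q * q ^ (j + r) * a / (d * e)) ^ j *
        wellPoisedTerm q (a * q ^ (2 * j)) (d * q ^ j) (e * q ^ j) (q ^ r) i := by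
  have hj : q ^ j ≠ 0 := pow_ne_zero j hq
  have hrev : qPoch (q ^ (j + i))⁻¹ q j =
      qPoch (q * q ^ i) q j * ((-1 / q) ^ j / (q ^ i) ^ j) / q ^ j.choose 2 := by
    have := qPoch_reverse hq (mul_ne_zero hq (pow_ne_zero i hq)) j
    rw [← div_pow, div_div, ← this]
    congr 1
    rw [pow_add]
    field_simp
  have ha2 : qPoch a q (j + i) * qPoch (a * q ^ (j + i)) q j =
      (1 - a) * (qPoch (q * a) q (2 * j) / (1 - a * q ^ (2 * j)) *
        qPoch (a * q ^ (2 * j)) q i) := by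
    rw [← mul_assoc, ← mul_div_assoc, mul_comm q a, ← qPoch_succ', qPoch_succ, mul_div_cancel_right₀ _ haj,
      ← qPoch_add,
      ← qPoch_add]
    congr 1
    ring
  have hqq := qPoch_add q q i j
  rw [add_comm i j] at hqq
  have s1 : q * (a * q ^ (2 * j)) / (d * q ^ j) = q * a / d * q ^ j := by
    rw [two_mul, pow_add]; field_simp
  have s2 : q * (a * q ^ (2 * j)) / (e * q ^ j) = q * a / e * q ^ j := by
    rw [two_mul, pow_add]; field_simp
  have s3 : q * q ^ r * (a * q ^ (2 * j)) = q * q ^ (j + r) * a * q ^ j := by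
    ring
  have s4 : (q ^ (j + r))⁻¹ * q ^ j = (q ^ r)⁻¹ := by
    rw [pow_add]; field_simp
  have s5 : q * q ^ (j + r) * a * q ^ j / (d * q ^ j * (e * q ^ j)) =
      q * q ^ (j + r) * a / (d * e) / q ^ j := by
    field_simp
  have s6 : 1 - a * q ^ (2 * (j + i)) = 1 - a * q ^ (2 * j) * q ^ (2 * i) := by ring
  have s7 : (q ^ i) ^ j = (q ^ j) ^ i := by rw [← pow_mul, ← pow_mul, mul_comm]
  have hji : (q ^ j) ^ i ≠ 0 := pow_ne_zero i hj
  rw [hqq] at hqi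
  have hqi1 := left_ne_zero_of_mul hqi
  have hqi2 := right_ne_zero_of_mul hqi
  simp only [wellPoisedTerm, s1, s2, s3, s5, s6]
  rw [hrev, hqq, qPoch_add d, qPoch_add e, qPoch_add (q * a / d), qPoch_add (q * a / e),
    qPoch_add (q * q ^ (j + r) * a), qPoch_add (q ^ (j + r))⁻¹, s4, s7, pow_add _ j i,
    div_pow _ (q ^ j) i]
  generalize (q * q ^ (j + r) * a / (d * e)) ^ i = z1
  generalize (q * q ^ (j + r) * a / (d * e)) ^ j = z2
  generalize (q ^ j) ^ i = z3 at *
  generalize qPoch (q * a / d * q ^ j) q i = x1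
  generalize qPoch (q * a / e * q ^ j) q i = x2
  generalize qPoch (q * a / d) q j = x3
  generalize qPoch (q * a / e) q j = x4
  generalize qPoch (q * q ^ (j + r) * a) q j = x5
  generalize qPoch (q * q ^ (j + r) * a * q ^ j) q i = x6
  generalize qPoch (d * q ^ j) q i = y1
  generalize qPoch (e * q ^ j) q i = y2
  generalize qPoch d q j = y3
  generalize qPoch e q j = y4
  generalize qPoch (q ^ r)⁻¹ q i = y5
  generalize qPoch (q ^ (j + r))⁻¹ q j = y6
  generalize qPoch q q i = w1 at *
  generalize qPoch (q * q ^ i) q j = w2 at *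
  generalize (-1 / q) ^ j = w3
  generalize q ^ j.choose 2 = w4
  generalize qPoch a q (j + i) = A1 at *
  generalize qPoch (a * q ^ (j + i)) q j = A2 at *
  calc
    _ = A1 * A2 / (1 - a) * (w2 / w2) * ((1 - a * q ^ (2 * j) * q ^ (2 * i)) *
          (y3 * y1 * y4 * y2 * y6 * y5) / (w1 * (x3 * x1) * (x4 * x2) * (x5 * x6)) *
          (z2 * z1) * (w3 / z3 / w4)) := by ring
    _ = _ := by
      rw [ha2, mul_div_cancel_left₀ _ ha1, div_self hqi2]
      ring

theorem sum_wellPoisedTerm_mul_qPoch {q a d e : ℂ} (hq : q ≠ 0) (ha0 : a ≠ 0) (hd : d ≠ 0)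
    (he : e ≠ 0) (j r : ℕ) (hqn : qPoch q q (j + r) ≠ 0)
    (ha : ∀ m ≤ 2 * (j + r), 1 - a * q ^ m ≠ 0)
    (h2 : qPoch (q * a / d) q (j + r) ≠ 0) (h3 : qPoch (q * a / e) q (j + r) ≠ 0)
    (h6 : qPoch ((q ^ (j + r))⁻¹ * d * e / a) q j ≠ 0) :
    ∑ i ∈ Finset.range (r + 1), wellPoisedTerm q a d e (q ^ (j + r)) (j + i) *
        (qPoch (q ^ (j + i))⁻¹ q j * qPoch (a * q ^ (j + i)) q j) =
      qPoch (q * a) q (j + r) * qPoch (q * a / (d * e)) q (j + r) /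
          (qPoch (q * a / d) q (j + r) * qPoch (q * a / e) q (j + r)) *
        (qPoch (q ^ (j + r))⁻¹ q j * qPoch d q j * qPoch e q j /
          qPoch ((q ^ (j + r))⁻¹ * d * e / a) q j) := by
  have hj : q ^ j ≠ 0 := pow_ne_zero j hq
  have hr : q ^ r ≠ 0 := pow_ne_zero r hq
  have ha1 : 1 - a ≠ 0 := by simpa using ha 0 (Nat.zero_le _)
  have s1 : q * (a * q ^ (2 * j)) / (d * q ^ j) = q * a / d * q ^ j := by
    rw [two_mul, pow_add]; field_simp
  have s2 : q * (a * q ^ (2 * j)) / (e * q ^ j) = q * a / e * q ^ j := by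
    rw [two_mul, pow_add]; field_simp
  have s3 : q * (a * q ^ (2 * j)) / (d * q ^ j * (e * q ^ j)) = q * a / (d * e) := by
    rw [two_mul, pow_add]; field_simp
  rw [Finset.sum_congr rfl fun i hi => wellPoisedTerm_mul_qPoch hq hd he ha1 j r i
    (qPoch_ne_zero_of_le (by have := Finset.mem_range.1 hi; omega) hqn) (ha _ (by omega)),
    ← Finset.mul_sum,
    sum_wellPoisedTerm hq (mul_ne_zero hd hj) (mul_ne_zero he hj) r
      (qPoch_ne_zero_of_le (by omega) hqn)
      (fun m hm => by rw [mul_assoc, ← pow_add]; exact ha _ (by omega))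
      (by rw [s1]; rw [qPoch_add] at h2; exact right_ne_zero_of_mul h2)
      (by rw [s2]; rw [qPoch_add] at h3; exact right_ne_zero_of_mul h3), s1, s2, s3]
  have hA : qPoch (q * a) q (2 * j) * qPoch (q * (a * q ^ (2 * j))) q r =
      qPoch (q * a) q (j + r) * qPoch (q * q ^ (j + r) * a) q j := by
    rw [← mul_assoc q a, ← qPoch_add, mul_right_comm q _ a, ← qPoch_add]
    congr 1
    omega
  have h5 : qPoch (q * q ^ (j + r) * a) q j ≠ 0 :=
    Finset.prod_ne_zero_iff.2 fun i hi => by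
      have := ha (j + r + 1 + i) (by have := Finset.mem_range.1 hi; omega)
      convert this using 2
      ring
  have hrev : qPoch ((q ^ (j + r))⁻¹ * d * e / a) q j =
      qPoch (q * a / (d * e) * q ^ r) q j * (-1 / (q * a / (d * e) * q ^ r)) ^ j /
        q ^ j.choose 2 := by
    rw [← qPoch_reverse hq (by positivity)]
    congr 1
    rw [pow_add]
    field_simp
  have hB : qPoch (q * a / (d * e)) q (j + r) =
      qPoch (q * a / (d * e)) q r * qPoch (q * a / (d * e) * q ^ r) q j := by
    rw [add_comm, qPoch_add]
  have hpow : (-1 / q) ^ j / q ^ j.choose 2 * (q * q ^ (j + r) * a / (d * e)) ^ j =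
      q ^ j.choose 2 / (-1 / (q * a / (d * e) * q ^ r)) ^ j := by
    have hjj : (q ^ j) ^ j = q ^ j * (q ^ j.choose 2) ^ 2 := by
      rw [← pow_mul, ← pow_mul, ← pow_add]
      congr 1
      rw [Nat.choose_two_right]
      cases j with
      | zero => rfl
      | succ j =>
        have := Nat.div_two_mul_two_of_even (Nat.even_mul_pred_self (j + 1))
        simp only [Nat.add_sub_cancel] at this ⊢
        rw [this]; ring
    have : q * q ^ (j + r) * a / (d * e) = q ^ j * (q * a / (d * e) * q ^ r) := by ring
    have hc : q ^ j.choose 2 ≠ 0 := pow_ne_zero _ hq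
    have hy : q * a / (d * e) * q ^ r ≠ 0 := by positivity
    rw [this]
    generalize q * a / (d * e) * q ^ r = y at *
    rw [mul_pow, hjj, neg_div, neg_div, neg_pow, neg_pow (1 / y), div_pow, div_pow, one_pow]
    rcases neg_one_pow_eq_or ℂ j with h | h <;> rw [h] <;> field_simp
  rw [hrev] at h6
  rw [hrev, hB]
  rw [qPoch_add] at h2 h3
  rw [qPoch_add (q * a / d), qPoch_add (q * a / e)]
  generalize hT : (-1 / (q * a / (d * e) * q ^ r)) ^ j = T at *
  have hc : q ^ j.choose 2 ≠ 0 := pow_ne_zero _ hq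
  have hT0 : T ≠ 0 := by rintro rfl; simp at h6
  have hY0 : qPoch (q * a / (d * e) * q ^ r) q j ≠ 0 := by intro h; simp [h] at h6
  have h2a := left_ne_zero_of_mul h2
  have h2b := right_ne_zero_of_mul h2
  have h3a := left_ne_zero_of_mul h3
  have h3b := right_ne_zero_of_mul h3
  generalize q ^ j.choose 2 = w at *
  generalize (-1 / q) ^ j = v1 at *
  generalize (q * q ^ (j + r) * a / (d * e)) ^ j = v2 at *
  generalize qPoch (q * a) q (2 * j) = p1 at *
  generalize qPoch (q * (a * q ^ (2 * j))) q r = p2 at *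
  generalize qPoch (q * q ^ (j + r) * a) q j = p3 at *
  generalize qPoch (q * a) q (j + r) = p4 at *
  generalize qPoch (q * a / d) q j = p5 at *
  generalize qPoch (q * a / e) q j = p6 at *
  generalize qPoch (q * a / d * q ^ j) q r = p7 at *
  generalize qPoch (q * a / e * q ^ j) q r = p8 at *
  generalize qPoch (q * a / (d * e) * q ^ r) q j = p9 at *
  generalize qPoch (q * a / (d * e)) q r = p10 at *
  generalize qPoch d q j = p11 at *
  generalize qPoch e q j = p12 at *
  generalize qPoch (q ^ (j + r))⁻¹ q j = p13 at *
  calc _ = (v1 / w * v2) * (p1 * p2) * p11 * p12 * p13 * p10 / (p5 * p6 * p3 * p7 * p8) := by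
        field_simp
    _ = _ := by
        rw [hpow, hA]
        field_simp

theorem watson_transformation_of_generic {n : ℕ} {q a b c d e : ℂ} (hq : q ≠ 0)
    (ha0 : a ≠ 0) (hb : b ≠ 0) (hc : c ≠ 0) (hd : d ≠ 0) (he : e ≠ 0)
    (hqn : qPoch q q n ≠ 0) (ha : ∀ m ≤ 2 * n, 1 - a * q ^ m ≠ 0)
    (h1 : qPoch (q * a / b) q n ≠ 0) (h2 : qPoch (q * a / c) q n ≠ 0)
    (h3 : qPoch (q * a / d) q n ≠ 0) (h4 : qPoch (q * a / e) q n ≠ 0)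
    (h6 : qPoch ((q ^ n)⁻¹ * d * e / a) q n ≠ 0) :
    ∑ k ∈ Finset.range (n + 1),
        (1 - a * q ^ (2 * k)) / (1 - a) *
          (qPoch a q k * qPoch b q k * qPoch c q k * qPoch d q k * qPoch e q k *
            qPoch (q ^ n)⁻¹ q k) /
          (qPoch q q k * qPoch (q * a / b) q k * qPoch (q * a / c) q k *
            qPoch (q * a / d) q k * qPoch (q * a / e) q k * qPoch (q ^ (n + 1) * a) q k) *
          (q ^ (n + 2) * a ^ 2 / (b * c * d * e)) ^ k
      = qPoch (q * a) q n * qPoch (q * a / (d * e)) q n /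
          (qPoch (q * a / d) q n * qPoch (q * a / e) q n) *
        ∑ k ∈ Finset.range (n + 1),
          qPoch (q ^ n)⁻¹ q k * qPoch d q k * qPoch e q k *
            qPoch (q * a / (b * c)) q k /
            (qPoch (q * a / b) q k * qPoch (q * a / c) q k *
              qPoch ((q ^ n)⁻¹ * d * e / a) q k * qPoch q q k) * q ^ k := by
  calc
    _ = ∑ k ∈ Finset.range (n + 1), wellPoisedTerm q a d e (q ^ n) k *
          ∑ j ∈ Finset.range (k + 1), saalschutzTerm q a b c (q ^ k) j := by
      refine Finset.sum_congr rfl fun k hk => ?_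
      have hkn : k ≤ n := Nat.lt_succ_iff.1 (Finset.mem_range.1 hk)
      rw [sum_saalschutzTerm hq hb hc k (qPoch_ne_zero_of_le hkn hqn)
        (qPoch_ne_zero_of_le hkn h1) (qPoch_ne_zero_of_le hkn h2), wellPoisedTerm,
        show q ^ (n + 2) * a ^ 2 / (b * c * d * e) =
          q * a / (b * c) * (q * q ^ n * a / (d * e)) by ring, mul_pow, ← pow_succ']
      ring
    _ = ∑ k ∈ Finset.range (n + 1), ∑ j ∈ Finset.range (n + 1),
          wellPoisedTerm q a d e (q ^ n) k * saalschutzTerm q a b c (q ^ k) j := by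
      refine Finset.sum_congr rfl fun k hk => ?_
      rw [Finset.mul_sum]
      refine Finset.sum_subset (Finset.range_subset_range.2 (Finset.mem_range.1 hk))
        fun j _ hj => ?_
      rw [saalschutzTerm, qPoch_inv_pow_eq_zero hq (by simpa using hj)]
      simp
    _ = _ := by
      rw [Finset.sum_comm, Finset.mul_sum]
      refine Finset.sum_congr rfl fun j hj => ?_
      obtain ⟨r, rfl⟩ := Nat.exists_eq_add_of_le (Nat.lt_succ_iff.1 (Finset.mem_range.1 hj))
      have key := sum_wellPoisedTerm_mul_qPoch hq ha0 hd he j r hqn ha h3 h4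
        (qPoch_ne_zero_of_le (Nat.le_add_right j r) h6)
      rw [add_assoc, Finset.sum_range_add, Finset.sum_eq_zero (s := Finset.range j), zero_add]
      · calc
          _ = (∑ i ∈ Finset.range (r + 1), wellPoisedTerm q a d e (q ^ (j + r)) (j + i) *
                (qPoch (q ^ (j + i))⁻¹ q j * qPoch (a * q ^ (j + i)) q j)) *
              (qPoch (q * a / (b * c)) q j /
                (qPoch q q j * qPoch (q * a / b) q j * qPoch (q * a / c) q j) * q ^ j) := by
            rw [Finset.sum_mul]
            refine Finset.sum_congr rfl fun i _ => ?_
            rw [saalschutzTerm]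
            ring
          _ = _ := by
            rw [key]
            ring
      · intro k hk
        rw [saalschutzTerm, qPoch_inv_pow_eq_zero hq (Finset.mem_range.1 hk)]
        simp

theorem continuousAt_qPoch {f : ℂ → ℂ} {x : ℂ} (hf : ContinuousAt f x) (q : ℂ) (k : ℕ) :
    ContinuousAt (fun y => qPoch (f y) q k) x := by
  unfold qPoch
  fun_prop

/-- Watson's transformation of a terminating `₈W₇` into a terminating balanced `₄φ₃`:
`₈W₇(a; b, c, d, e, q^{−n}; q, q^{n+2}a²/(bcde))
  = ((qa;q)_n (qa/(de);q)_n / ((qa/d;q)_n (qa/e;q)_n))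
    · ₄φ₃(q^{−n}, d, e, qa/(bc); qa/b, qa/c, q^{−n}de/a; q, q)`,
both series written out explicitly; `0 < ‖q‖ < 1`, `a,b,c,d,e ≠ 0`, `a ≠ 1`, and no
factor in the denominators vanishes. -/
theorem watson_transformation (n : ℕ) (q a b c d e : ℂ) (hq0 : 0 < ‖q‖) (hq1 : ‖q‖ < 1)
    (ha : a ≠ 0) (hb : b ≠ 0) (hc : c ≠ 0) (hd : d ≠ 0) (he : e ≠ 0) (ha1 : a ≠ 1)
    (h1 : qPoch (q * a / b) q n ≠ 0) (h2 : qPoch (q * a / c) q n ≠ 0)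
    (h3 : qPoch (q * a / d) q n ≠ 0) (h4 : qPoch (q * a / e) q n ≠ 0)
    (h5 : qPoch (q ^ (n + 1) * a) q n ≠ 0)
    (h6 : qPoch (q ^ (-(n : ℤ)) * d * e / a) q n ≠ 0) :
    ∑ k ∈ Finset.range (n + 1),
        (1 - a * q ^ (2 * k)) / (1 - a) *
          (qPoch a q k * qPoch b q k * qPoch c q k * qPoch d q k * qPoch e q k *
            qPoch (q ^ (-(n : ℤ))) q k) /
          (qPoch q q k * qPoch (q * a / b) q k * qPoch (q * a / c) q k *
            qPoch (q * a / d) q k * qPoch (q * a / e) q k * qPoch (q ^ (n + 1) * a) q k) *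
          (q ^ (n + 2) * a ^ 2 / (b * c * d * e)) ^ k
      = qPoch (q * a) q n * qPoch (q * a / (d * e)) q n /
          (qPoch (q * a / d) q n * qPoch (q * a / e) q n) *
        ∑ k ∈ Finset.range (n + 1),
          qPoch (q ^ (-(n : ℤ))) q k * qPoch d q k * qPoch e q k *
            qPoch (q * a / (b * c)) q k /
            (qPoch (q * a / b) q k * qPoch (q * a / c) q k *
              qPoch (q ^ (-(n : ℤ)) * d * e / a) q k * qPoch q q k) * q ^ k := by
  have hq : q ≠ 0 := norm_pos_iff.1 hq0
  have hqn : qPoch q q n ≠ 0 := Finset.prod_ne_zero_iff.2 fun j _ h => by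
    have hlt : ‖q ^ (j + 1)‖ < 1 := by
      rw [norm_pow]
      exact pow_lt_one₀ hq0.le hq1 j.succ_ne_zero
    rw [pow_succ', ← sub_eq_zero.1 h, norm_one] at hlt
    exact hlt.false
  simp only [zpow_neg, zpow_natCast] at h6 ⊢
  have c1 := continuousAt_qPoch (f := fun x => q * x / b) (x := a) (by fun_prop) q
  have c2 := continuousAt_qPoch (f := fun x => q * x / c) (x := a) (by fun_prop) q
  have c3 := continuousAt_qPoch (f := fun x => q * x / d) (x := a) (by fun_prop) q
  have c4 := continuousAt_qPoch (f := fun x => q * x / e) (x := a) (by fun_prop) q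
  have c5 := continuousAt_qPoch (f := fun x => q ^ (n + 1) * x) (x := a) (by fun_prop) q
  have c6 := continuousAt_qPoch (f := fun x => (q ^ n)⁻¹ * d * e / x) (x := a)
    (continuousAt_const.div continuousAt_id ha) q
  have c7 := continuousAt_qPoch (f := fun x => x) (x := a) (by fun_prop) q
  have c8 := continuousAt_qPoch (f := fun x => q * x) (x := a) (by fun_prop) q
  have c9 := continuousAt_qPoch (f := fun x => q * x / (d * e)) (x := a) (by fun_prop) q
  have c10 := continuousAt_qPoch (f := fun x => q * x / (b * c)) (x := a) (by fun_prop) q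
  have hgen : ∀ᶠ x in nhdsWithin a {a}ᶜ, ∀ m ∈ Finset.range (2 * n + 1), 1 - x * q ^ m ≠ 0 := by
    rw [Filter.eventually_all_finset]
    intro m _
    by_cases h : 1 - a * q ^ m = 0
    · filter_upwards [self_mem_nhdsWithin] with x hx h'
      exact hx (mul_right_cancel₀ (pow_ne_zero m hq) (sub_right_injective (h'.trans h.symm)))
    · have hm : ContinuousAt (fun x => 1 - x * q ^ m) a := by fun_prop
      exact nhdsWithin_le_nhds (hm.eventually_ne h)
  refine tendsto_nhds_unique_of_eventuallyEq (l := nhdsWithin a {a}ᶜ)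
    (f := fun a => ∑ k ∈ Finset.range (n + 1),
        (1 - a * q ^ (2 * k)) / (1 - a) *
          (qPoch a q k * qPoch b q k * qPoch c q k * qPoch d q k * qPoch e q k *
            qPoch (q ^ n)⁻¹ q k) /
          (qPoch q q k * qPoch (q * a / b) q k * qPoch (q * a / c) q k *
            qPoch (q * a / d) q k * qPoch (q * a / e) q k * qPoch (q ^ (n + 1) * a) q k) *
          (q ^ (n + 2) * a ^ 2 / (b * c * d * e)) ^ k)
    (g := fun a => qPoch (q * a) q n * qPoch (q * a / (d * e)) q n /
          (qPoch (q * a / d) q n * qPoch (q * a / e) q n) *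
        ∑ k ∈ Finset.range (n + 1),
          qPoch (q ^ n)⁻¹ q k * qPoch d q k * qPoch e q k *
            qPoch (q * a / (b * c)) q k /
            (qPoch (q * a / b) q k * qPoch (q * a / c) q k *
              qPoch ((q ^ n)⁻¹ * d * e / a) q k * qPoch q q k) * q ^ k)
    (ContinuousAt.tendsto ?_ |>.mono_left nhdsWithin_le_nhds)
    (ContinuousAt.tendsto ?_ |>.mono_left nhdsWithin_le_nhds) ?_
  · refine tendsto_finsetSum _ fun k hk => ?_
    have hkn : k ≤ n := Nat.lt_succ_iff.1 (Finset.mem_range.1 hk)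
    have h1a : 1 - a ≠ 0 := sub_ne_zero.2 ha1.symm
    have hw : ContinuousAt (fun x => (1 - x * q ^ (2 * k)) / (1 - x)) a := by
      fun_prop (disch := assumption)
    have hz : ContinuousAt (fun x => (q ^ (n + 2) * x ^ 2 / (b * c * d * e)) ^ k) a := by
      fun_prop
    have hnum := (c7 k).mul (continuousAt_const (y := qPoch b q k))
      |>.mul (continuousAt_const (y := qPoch c q k))
      |>.mul (continuousAt_const (y := qPoch d q k))
      |>.mul (continuousAt_const (y := qPoch e q k))
      |>.mul (continuousAt_const (y := qPoch (q ^ n)⁻¹ q k))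
    have hden := (continuousAt_const (y := qPoch q q k)).mul (c1 k)
      |>.mul (c2 k) |>.mul (c3 k) |>.mul (c4 k) |>.mul (c5 k)
    exact ((hw.mul hnum).div hden (by simp [qPoch_ne_zero_of_le hkn, *])).mul hz
  · refine (((c8 n).mul (c9 n)).div ((c3 n).mul (c4 n)) (mul_ne_zero h3 h4)).mul
      (tendsto_finsetSum _ fun k hk => ?_)
    have hkn : k ≤ n := Nat.lt_succ_iff.1 (Finset.mem_range.1 hk)
    exact ((continuousAt_const.mul (c10 k)).div
      ((((c1 k).mul (c2 k)).mul (c6 k)).mul continuousAt_const)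
      (by simp [qPoch_ne_zero_of_le hkn, *])).mul continuousAt_const
  · filter_upwards [hgen, nhdsWithin_le_nhds (continuousAt_id.eventually_ne ha),
      nhdsWithin_le_nhds ((c1 n).eventually_ne h1), nhdsWithin_le_nhds ((c2 n).eventually_ne h2),
      nhdsWithin_le_nhds ((c3 n).eventually_ne h3), nhdsWithin_le_nhds ((c4 n).eventually_ne h4),
      nhdsWithin_le_nhds ((c6 n).eventually_ne h6)] with x hx hx0 k1 k2 k3 k4 k6
    exact watson_transformation_of_generic hq hx0 hb hc hd he hqn
      (fun m hm => hx m (Finset.mem_range.2 (Nat.lt_succ_iff.2 hm))) k1 k2 k3 k4 k6
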